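/- Let κ, μ, m_d, r̂ > 0 and r > 0. Set K = μ(1+κ) and, for m_t > 1, let D₁(r; m_t) = (2(m_t−1)^{m_t} m_d^{m_d} K^μ r^{2μ−1} r̂^{2m_t} / ((m_d+μκ)^{m_d} B(m_t,μ)(K r² + (m_t−1)r̂²)^{m_t+μ})) ₂F₁(m_d, m_t+μ; μ; K μ κ r² / ((m_d+μκ)(K r² + (m_t−1)r̂²))) denote the double shadowed κ-μ Type I (example 1) PDF. Then lim_{m_t → ∞} D₁(r; m_t) = (2 m_d^{m_d}(1+κ)^μ μ^μ / (Γ(μ)(m_d+κμ)^{m_d})) (r^{2μ−1}/r̂^{2μ}) e^{−r²(1+κ)μ/r̂²} ₁F₁(m_d; μ; μ²κ(1+κ)r²/(r̂²(m_d+κμ))), i.e., the double shadowed κ-μ Type I (example 1) PDF converges pointwise to the single shadowed κ-μ Type I (Nakagami-m dominant shadowing) PDF as the multiplicative shadowing parameter tends to infinity. -/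

import Mathlib

open MeasureTheory Set

/-- Pochhammer (rising factorial) symbol `(a)_n = Γ(a+n)/Γ(a)`. -/
noncomputable def poch (a : ℝ) (n : ℕ) : ℝ := Real.Gamma (a + n) / Real.Gamma a

/-- Beta function `B(x,y) = Γ(x)Γ(y)/Γ(x+y)`. -/
noncomputable def betaFn (x y : ℝ) : ℝ := Real.Gamma x * Real.Gamma y / Real.Gamma (x + y)

/-- Modified Bessel function of the first kind of real order ν. -/
noncomputable def besselI (ν x : ℝ) : ℝ :=
  ∑' k : ℕ, (x / 2) ^ (ν + 2 * (k : ℝ)) / ((k.factorial : ℝ) * Real.Gamma (ν + (k : ℝ) + 1))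

/-- Modified Bessel function of the second kind of real order ν. -/
noncomputable def besselK (ν x : ℝ) : ℝ :=
  ∫ t in Ioi (0 : ℝ), Real.exp (-x * Real.cosh t) * Real.cosh (ν * t)

/-- Confluent hypergeometric function ₁F₁(a;b;z). -/
noncomputable def hyp1F1 (a b z : ℝ) : ℝ :=
  ∑' n : ℕ, poch a n * z ^ n / (poch b n * (n.factorial : ℝ))

/-- Gauss hypergeometric function ₂F₁(a,b;c;z). -/
noncomputable def hyp2F1 (a b c z : ℝ) : ℝ :=
  ∑' n : ℕ, poch a n * poch b n * z ^ n / (poch c n * (n.factorial : ℝ))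

/-- Tricomi confluent hypergeometric function U(a,b,z). -/
noncomputable def tricomiU (a b z : ℝ) : ℝ :=
  (1 / Real.Gamma a) *
    ∫ t in Ioi (0 : ℝ), Real.exp (-z * t) * t ^ (a - 1) * (1 + t) ^ (b - a - 1)

/-- Regularized generalized hypergeometric function ₃F̃₁(a₁,a₂,a₃;b;z). -/
noncomputable def hyp3F1reg (a₁ a₂ a₃ b z : ℝ) : ℝ :=
  ∑' n : ℕ, poch a₁ n * poch a₂ n * poch a₃ n * z ^ n /
    (Real.Gamma (b + n) * (n.factorial : ℝ))

/-- Regularized generalized hypergeometric function ₂F̃₂(a,b;c,d;z). -/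
noncomputable def hyp2F2reg (a b c d z : ℝ) : ℝ :=
  ∑' n : ℕ, poch a n * poch b n * z ^ n /
    (Real.Gamma (c + n) * Real.Gamma (d + n) * (n.factorial : ℝ))

theorem Gamma_add_le_Gamma_mul_rpow {x b : ℝ} (hx : 0 < x) (hb : 0 < b) (hb1 : b < 1) :
    Real.Gamma (x + b) ≤ Real.Gamma x * x ^ b := by
  have h := Real.Gamma_mul_add_mul_le_rpow_Gamma_mul_rpow_Gamma hx (add_pos hx one_pos)
    (sub_pos.2 hb1) hb (by ring)
  have hG := Real.Gamma_pos_of_pos hx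
  rw [Real.Gamma_add_one hx.ne', Real.mul_rpow hx.le hG.le] at h
  calc Real.Gamma (x + b) = Real.Gamma ((1 - b) * x + b * (x + 1)) := by congr 1; ring
    _ ≤ _ := h
    _ = (Real.Gamma x ^ (1 - b) * Real.Gamma x ^ b) * x ^ b := by ring
    _ = _ := by rw [← Real.rpow_add hG, sub_add_cancel, Real.rpow_one]

/-- The Gamma-ratio asymptotic `Γ(x + s) / Γ(x) ~ x ^ s` for `s ∈ (0, 1)`. -/
theorem tendsto_Gamma_add_div_of_lt_one {b : ℝ} (hb : 0 < b) (hb1 : b < 1) :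
    Filter.Tendsto (fun x : ℝ => Real.Gamma (x + b) / (Real.Gamma x * x ^ b))
      Filter.atTop (nhds 1) := by
  have hlim : Filter.Tendsto (fun x : ℝ => (1 + b / x) ^ (b - 1)) Filter.atTop (nhds 1) := by
    have h : Filter.Tendsto (fun x : ℝ => 1 + b / x) Filter.atTop (nhds 1) := by
      simpa using (Filter.Tendsto.div_atTop (tendsto_const_nhds (x := b))
        Filter.tendsto_id).const_add (1 : ℝ)
    simpa using h.rpow_const (p := b - 1) (Or.inl one_ne_zero)
  refine tendsto_of_tendsto_of_tendsto_of_le_of_le' hlim tendsto_const_nhds ?_ ?_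
  · filter_upwards [Filter.eventually_gt_atTop 0] with x hx
    have hG := Real.Gamma_pos_of_pos hx
    have hxb : 0 < x + b := by positivity
    have h := Gamma_add_le_Gamma_mul_rpow hxb (sub_pos.2 hb1) (by linarith)
    rw [show x + b + (1 - b) = x + 1 by ring, Real.Gamma_add_one hx.ne'] at h
    rw [le_div_iff₀ (by positivity)]
    have e : (1 + b / x) ^ (b - 1) = (x + b) ^ (b - 1) / x ^ (b - 1) := by
      rw [← Real.div_rpow hxb.le hx.le]
      congr 1
      field_simp
    have e2 : (x + b) ^ (b - 1) * (x + b) ^ (1 - b) = 1 := by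
      rw [← Real.rpow_add hxb]; simp
    have e3 : x ^ b = x ^ (b - 1) * x := by
      rw [Real.rpow_sub_one hx.ne']; field_simp
    have hp : 0 < (x + b) ^ (b - 1) := by positivity
    have hp2 : 0 < x ^ (b - 1) := by positivity
    calc (1 + b / x) ^ (b - 1) * (Real.Gamma x * x ^ b)
        = (x + b) ^ (b - 1) * (x * Real.Gamma x) := by rw [e, e3]; field_simp
      _ ≤ (x + b) ^ (b - 1) * (Real.Gamma (x + b) * (x + b) ^ (1 - b)) := by gcongr
      _ = Real.Gamma (x + b) := by rw [mul_left_comm, e2, mul_one]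
  · filter_upwards [Filter.eventually_gt_atTop 0] with x hx
    have hG := Real.Gamma_pos_of_pos hx
    exact div_le_one_of_le₀ (Gamma_add_le_Gamma_mul_rpow hx hb hb1) (by positivity)

theorem tendsto_Gamma_add_div_add_one {b : ℝ} (hb : 0 ≤ b)
    (h : Filter.Tendsto (fun x : ℝ => Real.Gamma (x + b) / (Real.Gamma x * x ^ b))
      Filter.atTop (nhds 1)) :
    Filter.Tendsto (fun x : ℝ => Real.Gamma (x + (b + 1)) / (Real.Gamma x * x ^ (b + 1)))
      Filter.atTop (nhds 1) := by
  have h1 : Filter.Tendsto (fun x : ℝ => 1 + b / x) Filter.atTop (nhds 1) := by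
    simpa using (Filter.Tendsto.div_atTop (tendsto_const_nhds (x := b))
      Filter.tendsto_id).const_add (1 : ℝ)
  have h2 := h1.mul h
  rw [one_mul] at h2
  refine h2.congr' ?_
  filter_upwards [Filter.eventually_gt_atTop 0] with x hx
  have hG := Real.Gamma_pos_of_pos hx
  rw [← add_assoc, Real.Gamma_add_one (by positivity), Real.rpow_add_one hx.ne']
  field_simp

/-- The Gamma-ratio asymptotic `Γ(x + s) / Γ(x) ~ x ^ s` for `s ≥ 0`. -/
theorem tendsto_Gamma_add_div {s : ℝ} (hs : 0 ≤ s) :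
    Filter.Tendsto (fun x : ℝ => Real.Gamma (x + s) / (Real.Gamma x * x ^ s))
      Filter.atTop (nhds 1) := by
  have key : ∀ n : ℕ, Filter.Tendsto (fun x : ℝ => Real.Gamma (x + (Int.fract s + n)) /
      (Real.Gamma x * x ^ (Int.fract s + n))) Filter.atTop (nhds 1) := by
    intro n
    induction n with
    | zero =>
      rcases (Int.fract_nonneg s).eq_or_lt with h | h
      · rw [← h]
        refine tendsto_const_nhds.congr' ?_
        filter_upwards [Filter.eventually_gt_atTop 0] with x hx
        simp [(Real.Gamma_pos_of_pos hx).ne']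
      · simpa using tendsto_Gamma_add_div_of_lt_one h (Int.fract_lt_one s)
    | succ n ih =>
      have := tendsto_Gamma_add_div_add_one
        (add_nonneg (Int.fract_nonneg s) n.cast_nonneg) ih
      simpa [add_assoc] using this
  have h := key ⌊s⌋₊
  rwa [← Int.self_sub_floor, natCast_floor_eq_intCast_floor hs, sub_add_cancel] at h

theorem poch_zero {a : ℝ} (ha : 0 < a) : poch a 0 = 1 := by
  simp [poch, (Real.Gamma_pos_of_pos ha).ne']

theorem poch_succ {a : ℝ} (ha : 0 < a) (n : ℕ) : poch a (n + 1) = poch a n * (a + n) := by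
  have h : a + n ≠ 0 := by positivity
  simp only [poch, Nat.cast_add, Nat.cast_one, ← add_assoc, Real.Gamma_add_one h]
  ring

theorem poch_pos {a : ℝ} (ha : 0 < a) (n : ℕ) : 0 < poch a n :=
  div_pos (Real.Gamma_pos_of_pos (by positivity)) (Real.Gamma_pos_of_pos ha)

theorem poch_mul_pow_le {s z C δ : ℝ} (hs : 0 < s) (hz : 0 ≤ z) (hsz : s * z ≤ C) (hzδ : z ≤ δ)
    (n : ℕ) : poch s n * z ^ n ≤ ∏ i ∈ Finset.range n, (C + i * δ) := by
  induction n with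
  | zero => simp [poch_zero hs]
  | succ n ih =>
    rw [poch_succ hs, Finset.prod_range_succ, pow_succ]
    have hp := poch_pos hs n
    have hsz0 : 0 ≤ s * z := by positivity
    have h1 : (s + n) * z ≤ C + n * δ := by
      rw [add_mul]
      gcongr
    calc poch s n * (s + n) * (z ^ n * z) = poch s n * z ^ n * ((s + n) * z) := by ring
      _ ≤ _ := by
        refine mul_le_mul ih h1 (by positivity) (le_trans ?_ ih)
        positivity

theorem summable_poch_div_mul_prod {a b C : ℝ} (ha : 0 < a) (hb : 0 < b) (hC : 0 < C) :
    Summable fun n : ℕ => poch a n / (poch b n * (n.factorial : ℝ)) *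
      ∏ i ∈ Finset.range n, (C + i * (1 / 2 : ℝ)) := by
  have hpos : ∀ n : ℕ, 0 < poch a n / (poch b n * (n.factorial : ℝ)) *
      ∏ i ∈ Finset.range n, (C + i * (1 / 2 : ℝ)) := fun n => by
    have h1 := poch_pos ha n
    have h2 := poch_pos hb n
    have h3 : 0 < ∏ i ∈ Finset.range n, (C + i * (1 / 2 : ℝ)) :=
      Finset.prod_pos fun i _ => by positivity
    positivity
  refine summable_of_ratio_test_tendsto_lt_one (l := 1 / 2) (by norm_num)
    (Filter.Eventually.of_forall fun n => (hpos n).ne') ?_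
  have hinv (c : ℝ) : Filter.Tendsto (fun n : ℕ => c / (n : ℝ)) Filter.atTop (nhds 0) :=
    tendsto_const_div_atTop_nhds_zero_nat c
  have hlim : Filter.Tendsto (fun n : ℕ => (1 + a / (n : ℝ)) / (1 + b / (n : ℝ)) *
      ((C / (n : ℝ) + 1 / 2) / (1 + 1 / (n : ℝ)))) Filter.atTop (nhds (1 / 2)) := by
    have h := (((hinv a).const_add 1).div ((hinv b).const_add 1) (by norm_num)).mul
      (((hinv C).add_const (1 / 2)).div ((hinv 1).const_add 1) (by norm_num))
    simpa using h
  refine hlim.congr' ?_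
  filter_upwards [Filter.eventually_gt_atTop 0] with n hn
  have hn' : (0 : ℝ) < n := by exact_mod_cast hn
  rw [Real.norm_of_nonneg (hpos _).le, Real.norm_of_nonneg (hpos _).le, poch_succ ha,
    poch_succ hb, Finset.prod_range_succ, Nat.factorial_succ]
  have h1 := poch_pos ha n
  have h2 := poch_pos hb n
  have h3 : 0 < ∏ i ∈ Finset.range n, (C + i * (1 / 2 : ℝ)) :=
    Finset.prod_pos fun i _ => by positivity
  have h4 : (0 : ℝ) < n.factorial := by exact_mod_cast n.factorial_pos
  push_cast
  generalize ∏ i ∈ Finset.range n, (C + i * (1 / 2 : ℝ)) = P at *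
  field_simp
  ring

/-- Confluence `₂F₁(a, s; b; z) → ₁F₁(a; b; L)` as `z → 0⁺` and `s z → L`. -/
theorem tendsto_hyp2F1_hyp1F1 {ι : Type*} {l : Filter ι} {a b L : ℝ} {s z : ι → ℝ}
    (ha : 0 < a) (hb : 0 < b) (hL : 0 ≤ L) (hs : ∀ᶠ i in l, 0 < s i) (hz : ∀ᶠ i in l, 0 ≤ z i)
    (hz0 : Filter.Tendsto z l (nhds 0)) (hsz : Filter.Tendsto (fun i => s i * z i) l (nhds L)) :
    Filter.Tendsto (fun i => hyp2F1 a (s i) b (z i)) l (nhds (hyp1F1 a b L)) := by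
  unfold hyp2F1 hyp1F1
  refine tendsto_tsum_of_dominated_convergence
    (summable_poch_div_mul_prod ha hb (C := L + 1) (by positivity)) ?_ ?_
  · intro n
    have key : Filter.Tendsto (fun i => poch (s i) n * z i ^ n) l (nhds (L ^ n)) := by
      induction n with
      | zero =>
        refine tendsto_const_nhds.congr' ?_
        filter_upwards [hs] with i hi
        simp [poch_zero hi]
      | succ n ih =>
        have h := ih.mul (hsz.add (hz0.const_mul (n : ℝ)))
        rw [mul_zero, add_zero, ← pow_succ] at h
        refine h.congr' ?_
        filter_upwards [hs] with i hi
        rw [poch_succ hi]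
        ring
    refine ((key.const_mul (poch a n)).div_const (poch b n * (n.factorial : ℝ))).congr
      fun i => ?_
    ring
  · filter_upwards [hs, hz, hz0.eventually_le_const (by norm_num : (0 : ℝ) < 1 / 2),
      hsz.eventually_le_const (lt_add_one L)] with i hsi hzi hzi' hszi n
    have h1 := poch_pos ha n
    have h2 := poch_pos hb n
    have h3 := poch_pos hsi n
    rw [Real.norm_of_nonneg (by positivity)]
    calc poch a n * poch (s i) n * z i ^ n / (poch b n * (n.factorial : ℝ))
        = poch a n / (poch b n * (n.factorial : ℝ)) * (poch (s i) n * z i ^ n) := by ring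
      _ ≤ _ := by
        gcongr
        exact poch_mul_pow_le hsi hzi hszi hzi' n

/-- The limit `(1 + A / ((x - 1) R)) ^ (-x) → exp (-A / R)`, with the denominator cleared. -/
theorem tendsto_rpow_div_add_rpow {A R : ℝ} (hA : 0 < A) (hR : 0 < R) :
    Filter.Tendsto (fun x : ℝ => (x - 1) ^ x * R ^ x / (A + (x - 1) * R) ^ x)
      Filter.atTop (nhds (Real.exp (-(A / R)))) := by
  have hlim : Filter.Tendsto (fun x : ℝ => (1 + A / ((x - 1) * R)) ^ x) Filter.atTop
      (nhds (Real.exp (A / R))) := by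
    apply Real.tendsto_one_add_rpow_exp_of_tendsto
    have h : Filter.Tendsto (fun x : ℝ => A / R + (A / R) / (x - 1)) Filter.atTop
        (nhds (A / R)) := by
      simpa [sub_eq_add_neg] using (Filter.Tendsto.div_atTop (tendsto_const_nhds (x := A / R))
        (Filter.tendsto_atTop_add_const_right Filter.atTop (-1 : ℝ)
          Filter.tendsto_id)).const_add (A / R)
    refine h.congr' ?_
    filter_upwards [Filter.eventually_gt_atTop 1] with x hx
    have : x - 1 ≠ 0 := by linarith
    field_simp
    ring
  rw [Real.exp_neg]
  refine (hlim.inv₀ (Real.exp_pos _).ne').congr' ?_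
  filter_upwards [Filter.eventually_gt_atTop 1] with x hx
  have hx1 : 0 < x - 1 := by linarith
  rw [← Real.mul_rpow hx1.le hR.le, ← Real.div_rpow (by positivity) (by positivity),
    ← Real.inv_rpow (by positivity)]
  congr 1
  field_simp
  ring

theorem tendsto_id_div_add_mul {A R : ℝ} (hR : 0 < R) (c : ℝ) :
    Filter.Tendsto (fun x : ℝ => (x + c) / (A + (x - 1) * R)) Filter.atTop (nhds (1 / R)) := by
  have hinv (d : ℝ) : Filter.Tendsto (fun x : ℝ => d / x) Filter.atTop (nhds 0) :=
    Filter.Tendsto.div_atTop tendsto_const_nhds Filter.tendsto_id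
  have h := ((hinv c).const_add 1).div ((hinv (A - R)).const_add R) (by simpa using hR.ne')
  rw [add_zero, add_zero] at h
  refine h.congr' ?_
  filter_upwards [Filter.eventually_gt_atTop 0] with x hx
  simp only [Pi.div_apply]
  rw [← mul_div_mul_left _ _ hx.ne']
  congr 1 <;> field_simp
  ring

/-- Table III: the double shadowed κ-μ Type I (example 1) PDF converges
pointwise to the single shadowed κ-μ Type I (Nakagami-m dominant shadowing)
PDF as the multiplicative shadowing parameter m_t → ∞. -/
theorem double_shadowed_typeI_example1_limit_mt
    (κ μ md rhat r K : ℝ)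
    (hκ : 0 < κ) (hμ : 0 < μ) (hmd : 0 < md) (hrhat : 0 < rhat) (hr : 0 < r)
    (hK : K = μ * (1 + κ)) :
    Filter.Tendsto
      (fun mt : ℝ =>
        (2 * (mt - 1) ^ mt * md ^ md * K ^ μ * r ^ (2 * μ - 1) * rhat ^ (2 * mt) /
            ((md + μ * κ) ^ md * betaFn mt μ *
              (K * r ^ 2 + (mt - 1) * rhat ^ 2) ^ (mt + μ))) *
          hyp2F1 md (mt + μ) μ
            (K * μ * κ * r ^ 2 / ((md + μ * κ) * (K * r ^ 2 + (mt - 1) * rhat ^ 2))))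
      Filter.atTop
      (nhds ((2 * md ^ md * (1 + κ) ^ μ * μ ^ μ /
          (Real.Gamma μ * (md + κ * μ) ^ md)) *
        (r ^ (2 * μ - 1) / rhat ^ (2 * μ)) *
        Real.exp (-(r ^ 2) * (1 + κ) * μ / rhat ^ 2) *
        hyp1F1 md μ (μ ^ 2 * κ * (1 + κ) * r ^ 2 / (rhat ^ 2 * (md + κ * μ))))) := by
  subst hK
  set A : ℝ := μ * (1 + κ) * r ^ 2 with hA_def
  set R : ℝ := rhat ^ 2 with hR_def
  have hA : 0 < A := by positivity
  have hR : 0 < R := by positivity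
  have hq : 0 < md + μ * κ := by positivity
  have hGμ := Real.Gamma_pos_of_pos hμ
  set c : ℝ := μ * (1 + κ) * μ * κ * r ^ 2 / (md + μ * κ) with hc_def
  have hc : 0 < c := by positivity
  have hden : Filter.Tendsto (fun x : ℝ => A + (x - 1) * R) Filter.atTop Filter.atTop :=
    Filter.tendsto_atTop_add_const_left _ _ <|
      (Filter.tendsto_atTop_add_const_right _ (-1 : ℝ) Filter.tendsto_id).atTop_mul_const hR
  have hz : ∀ x : ℝ, μ * (1 + κ) * μ * κ * r ^ 2 / ((md + μ * κ) * (A + (x - 1) * R)) =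
      c / (A + (x - 1) * R) := fun x => by rw [hc_def, div_div]
  have hF : Filter.Tendsto (fun x : ℝ => hyp2F1 md (x + μ) μ (c / (A + (x - 1) * R)))
      Filter.atTop (nhds (hyp1F1 md μ (c / R))) := by
    refine tendsto_hyp2F1_hyp1F1 hmd hμ (by positivity) ?_ ?_ ?_ ?_
    · filter_upwards [Filter.eventually_gt_atTop 0] with x hx
      positivity
    · filter_upwards [hden.eventually_gt_atTop 0] with x hx
      positivity
    · exact Filter.Tendsto.div_atTop tendsto_const_nhds hden
    · have h := (tendsto_id_div_add_mul (A := A) hR μ).const_mul c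
      rw [mul_one_div] at h
      refine h.congr fun x => ?_
      ring
  have hratio : Filter.Tendsto (fun x : ℝ => (x / (A + (x - 1) * R)) ^ μ) Filter.atTop
      (nhds ((1 / R) ^ μ)) := by
    have h := tendsto_id_div_add_mul (A := A) hR 0
    simp only [add_zero] at h
    exact h.rpow_const (Or.inr hμ.le)
  have hlim := ((((tendsto_rpow_div_add_rpow hA hR).mul (tendsto_Gamma_add_div hμ.le)).mul
    hratio).const_mul (2 * md ^ md * (μ * (1 + κ)) ^ μ * r ^ (2 * μ - 1) /
      ((md + μ * κ) ^ md * Real.Gamma μ))).mul hF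
  have hRμ : rhat ^ (2 * μ) = R ^ μ := by
    rw [Real.rpow_mul hrhat.le, Real.rpow_two]
  have harg : μ ^ 2 * κ * (1 + κ) * r ^ 2 / (R * (md + κ * μ)) = c / R := by
    rw [hc_def, mul_comm κ μ]
    field_simp
  have hexp : -(r ^ 2) * (1 + κ) * μ / R = -(A / R) := by
    rw [hA_def]
    ring
  rw [harg, hexp, hRμ, mul_comm κ μ]
  convert hlim.congr' ?_ using 2
  · rw [Real.mul_rpow hμ.le (by positivity), Real.div_rpow one_pos.le hR.le, Real.one_rpow]
    field_simp
  · filter_upwards [Filter.eventually_gt_atTop 1, hden.eventually_gt_atTop 0] with x hx hD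
    have hx0 : 0 < x := by linarith
    have hGx := Real.Gamma_pos_of_pos hx0
    have hGxμ := Real.Gamma_pos_of_pos (add_pos hx0 hμ)
    have hRx : rhat ^ (2 * x) = R ^ x := by
      rw [Real.rpow_mul hrhat.le, Real.rpow_two]
    rw [hz, hRx, betaFn, Real.rpow_add hD, Real.div_rpow hx0.le hD.le]
    congr 1
    field_simp
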